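/- Let S ⊂ ℝ be a subring finitely generated as a ℤ-module with field of fractions K, and let Γ ⊂ ℝⁿ be a free S-module of rank n spanning ℝⁿ. If there exists a basis matrix B_Γ ∈ GL(n,ℝ) of Γ such that the Gram matrix B_Γᵗ B_Γ has all entries in K, then every non-zero vector of Γ defines a coincidence reflection of Γ, and every coincidence isometry of Γ is a product of at most n reflections defined by non-zero elements of Γ. -/

import Mathlib

open Matrix

/-- Two additive subgroups of `ℝⁿ` are commensurate if their intersection has
finite index in both. -/
def Commensurate {n : ℕ} (Γ Γ' : AddSubgroup (Fin n → ℝ)) : Prop :=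
  (Γ'.addSubgroupOf Γ).index ≠ 0 ∧ (Γ.addSubgroupOf Γ').index ≠ 0

/-- The matrix of the reflection `ρ_γ : x ↦ x - 2(⟨x,γ⟩/⟨γ,γ⟩)γ` along `γ`. -/
noncomputable def reflMatrix {n : ℕ} (γ : Fin n → ℝ) : Matrix (Fin n) (Fin n) ℝ :=
  1 - (2 / dotProduct γ γ) • Matrix.vecMulVec γ γ

/-- `Q` (acting on `ℝⁿ` by `x ↦ Q.mulVec x`) is a coincidence isometry of `Γ`:
it is orthogonal and `Γ` is commensurate with its image `Q(Γ)`. -/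
def IsCoincidenceIsometry {n : ℕ} (Γ : AddSubgroup (Fin n → ℝ))
    (Q : Matrix (Fin n) (Fin n) ℝ) : Prop :=
  Q ∈ Matrix.orthogonalGroup (Fin n) ℝ ∧
    Commensurate Γ (Γ.map Q.mulVecLin.toAddMonoidHom)

/-- `Q` is a product of at most `n` reflections along non-zero elements of `Γ`. -/
def IsProdOfAtMostNCoincReflections {n : ℕ} (Γ : AddSubgroup (Fin n → ℝ))
    (Q : Matrix (Fin n) (Fin n) ℝ) : Prop :=
  ∃ k : ℕ, k ≤ n ∧ ∃ g : Fin k → (Fin n → ℝ), (∀ i, g i ∈ Γ ∧ g i ≠ 0) ∧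
    Q = (List.ofFn fun i => reflMatrix (g i)).prod

/-- `b` is an `S`-basis of `Γ` which is also an `ℝ`-basis of `ℝⁿ`; i.e. `Γ` is
a free `S`-module of rank `n` spanning `ℝⁿ` with basis `b`. -/
def IsSBasisOf {n : ℕ} (S : Subring ℝ) (b : Fin n → (Fin n → ℝ))
    (Γ : AddSubgroup (Fin n → ℝ)) : Prop :=
  LinearIndependent ℝ b ∧ Submodule.span ℝ (Set.range b) = ⊤ ∧
    ∀ x, x ∈ Γ ↔ ∃ c : Fin n → ℝ, (∀ i, c i ∈ S) ∧ x = ∑ i, c i • b i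

theorem reflMatrix_mulVec {n : ℕ} (γ x : Fin n → ℝ) :
    reflMatrix γ *ᵥ x = x - (2 * (γ ⬝ᵥ x) / (γ ⬝ᵥ γ)) • γ := by
  rw [reflMatrix, sub_mulVec, one_mulVec, smul_mulVec, vecMulVec_mulVec, op_smul_eq_smul,
    smul_smul]
  congr 2
  ring

theorem reflMatrix_mul_self {n : ℕ} (γ : Fin n → ℝ) : reflMatrix γ * reflMatrix γ = 1 := by
  refine ext_of_mulVec_single fun i => ?_
  rw [← mulVec_mulVec, one_mulVec, reflMatrix_mulVec, reflMatrix_mulVec]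
  by_cases hγ : γ = 0
  · simp [hγ]
  have h : γ ⬝ᵥ γ ≠ 0 := mt dotProduct_self_eq_zero.1 hγ
  rw [dotProduct_sub, dotProduct_smul, smul_eq_mul, sub_sub, ← add_smul, sub_eq_self]
  convert zero_smul ℝ γ
  field_simp
  ring

theorem reflMatrix_transpose {n : ℕ} (γ : Fin n → ℝ) : (reflMatrix γ)ᵀ = reflMatrix γ := by
  simp [reflMatrix, transpose_sub, transpose_smul, transpose_vecMulVec]

theorem reflMatrix_mem_orthogonalGroup {n : ℕ} (γ : Fin n → ℝ) :
    reflMatrix γ ∈ orthogonalGroup (Fin n) ℝ := by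
  rw [mem_orthogonalGroup_iff, reflMatrix_transpose, reflMatrix_mul_self]

theorem reflMatrix_smul {n : ℕ} {c : ℝ} (hc : c ≠ 0) (γ : Fin n → ℝ) :
    reflMatrix (c • γ) = reflMatrix γ := by
  have h : 2 / (c * (c * (γ ⬝ᵥ γ))) * (c * c) = 2 / (γ ⬝ᵥ γ) := by
    rw [← mul_assoc c c, div_mul_eq_div_div_swap, div_mul_cancel₀ _ (mul_ne_zero hc hc)]
  rw [reflMatrix, reflMatrix, smul_dotProduct, dotProduct_smul, smul_eq_mul, smul_eq_mul,
    smul_vecMulVec, vecMulVec_smul, smul_smul, smul_smul, mul_assoc, h]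

theorem reflMatrix_sub_mulVec {n : ℕ} {x y : Fin n → ℝ} (hxy : y ≠ x)
    (h : x ⬝ᵥ x = y ⬝ᵥ y) : reflMatrix (y - x) *ᵥ y = x := by
  have h0 : (y - x) ⬝ᵥ (y - x) ≠ 0 := mt dotProduct_self_eq_zero.1 (sub_ne_zero.2 hxy)
  have h1 : 2 * ((y - x) ⬝ᵥ y) = (y - x) ⬝ᵥ (y - x) := by
    simp only [sub_dotProduct, dotProduct_sub, h, dotProduct_comm x y]
    ring
  rw [reflMatrix_mulVec, h1, div_self h0, one_smul, sub_sub_cancel]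

theorem reflMatrix_mulVec_of_dotProduct_eq_zero {n : ℕ} {γ x : Fin n → ℝ} (h : γ ⬝ᵥ x = 0) :
    reflMatrix γ *ᵥ x = x := by
  simp [reflMatrix_mulVec, h]

theorem mulVec_dotProduct_mulVec {n : ℕ} {Q : Matrix (Fin n) (Fin n) ℝ}
    (hQ : Q ∈ orthogonalGroup (Fin n) ℝ) (x y : Fin n → ℝ) :
    (Q *ᵥ x) ⬝ᵥ (Q *ᵥ y) = x ⬝ᵥ y := by
  rw [dotProduct_mulVec, ← mulVec_transpose, mulVec_mulVec,
    (mem_orthogonalGroup_iff' _ _).1 hQ, one_mulVec]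

/-- If `G` is finitely generated and each of its elements has a non-zero multiple in `H`, then
`G ⊓ H` has finite index in `G`. -/
theorem AddSubgroup.addSubgroupOf_index_ne_zero {M : Type*} [AddCommGroup M]
    {G H : AddSubgroup M} [AddGroup.FG G] (h : ∀ x ∈ G, ∃ m : ℤ, m ≠ 0 ∧ m • x ∈ H) :
    (H.addSubgroupOf G).index ≠ 0 := by
  have : Finite (G ⧸ H.addSubgroupOf G) := by
    refine AddCommGroup.finite_of_fg_isAddTorsion _ ?_
    intro q
    induction q using QuotientAddGroup.induction_on with
    | H x =>
      obtain ⟨m, hm, hx⟩ := h x x.2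
      refine isOfFinAddOrder_iff_zsmul_eq_zero.2 ⟨m, hm, ?_⟩
      rw [← QuotientAddGroup.mk_zsmul, QuotientAddGroup.eq_zero_iff]
      exact hx
  exact AddSubgroup.index_ne_zero_of_finite

theorem AddSubgroup.index_addSubgroupOf_nsmul_mem {M : Type*} [AddCommGroup M]
    (G H : AddSubgroup M) {x : M} (hx : x ∈ G) : (H.addSubgroupOf G).index • x ∈ H :=
  (H.addSubgroupOf G).nsmul_index_mem ⟨x, hx⟩

theorem exists_mul_eq_intCast {S : Type*} [CommRing S] [IsDomain S] [Module.Finite ℤ S]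
    {s : S} (hs : s ≠ 0) : ∃ (t : S) (m : ℤ), m ≠ 0 ∧ s * t = m := by
  obtain ⟨m, hm, hm0⟩ := Submodule.exists_mem_ne_zero_of_ne_bot <|
    Ideal.comap_ne_bot_of_integral_mem (R := ℤ) hs (Ideal.mem_span_singleton_self s)
      (Algebra.IsIntegral.isIntegral s)
  obtain ⟨t, ht⟩ := Ideal.mem_span_singleton.1 (Ideal.mem_comap.1 hm)
  exact ⟨t, m, hm0, by simpa using ht.symm⟩

theorem IsSBasisOf.mem_iff {n : ℕ} {S : Subring ℝ} {b : Fin n → (Fin n → ℝ)}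
    {Γ : AddSubgroup (Fin n → ℝ)} (hb : IsSBasisOf S b Γ) {x : Fin n → ℝ} :
    x ∈ Γ ↔ x ∈ Submodule.span S (Set.range b) := by
  rw [hb.2.2, Submodule.mem_span_range_iff_exists_fun]
  constructor
  · rintro ⟨c, hc, rfl⟩
    exact ⟨fun i => ⟨c i, hc i⟩, rfl⟩
  · rintro ⟨c, rfl⟩
    exact ⟨fun i => c i, fun i => (c i).2, rfl⟩

theorem IsSBasisOf.fg {n : ℕ} {S : Subring ℝ} [Module.Finite ℤ S] {b : Fin n → (Fin n → ℝ)}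
    {Γ : AddSubgroup (Fin n → ℝ)} (hb : IsSBasisOf S b Γ) : AddGroup.FG Γ := by
  obtain rfl : Γ = (Submodule.span S (Set.range b)).toAddSubgroup :=
    AddSubgroup.ext fun _ => hb.mem_iff
  have : Module.Finite S (Submodule.span S (Set.range b)) :=
    Module.Finite.span_of_finite S (Set.finite_range b)
  have : Module.Finite ℤ (Submodule.span S (Set.range b)) := Module.Finite.trans S _
  exact Module.Finite.iff_addGroup_fg.1 this

theorem exists_zsmul_mem_span {M : Type*} [AddCommGroup M] [Module ℝ M] {S : Subring ℝ}
    [Module.Finite ℤ S] {K : Subfield ℝ}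
    (hK : ∀ x ∈ K, ∃ a b : ℝ, a ∈ S ∧ b ∈ S ∧ b ≠ 0 ∧ x = a / b) {s : Set M} {x : M}
    (hx : x ∈ Submodule.span K s) : ∃ m : ℤ, m ≠ 0 ∧ m • x ∈ Submodule.span S s := by
  induction hx using Submodule.span_induction with
  | mem x h => exact ⟨1, one_ne_zero, by simpa using Submodule.subset_span h⟩
  | zero => exact ⟨1, one_ne_zero, by simp⟩
  | add x y _ _ hx hy =>
    obtain ⟨p, hp, hpx⟩ := hx
    obtain ⟨q, hq, hqy⟩ := hy
    refine ⟨p * q, mul_ne_zero hp hq, ?_⟩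
    rw [smul_add, mul_comm, mul_smul, mul_comm, mul_smul]
    exact add_mem (zsmul_mem hpx q) (zsmul_mem hqy p)
  | smul k x _ hx =>
    obtain ⟨p, hp, hpx⟩ := hx
    obtain ⟨a, d, ha, hd, hd0, hk⟩ := hK k k.2
    obtain ⟨t, m, hm, hdt⟩ := exists_mul_eq_intCast (s := (⟨d, hd⟩ : S))
      (fun h => hd0 (congrArg Subtype.val h))
    have hdt' : d * t = m := by simpa using congrArg Subtype.val hdt
    refine ⟨m * p, mul_ne_zero hm hp, ?_⟩
    convert Submodule.smul_mem _ ((⟨a, ha⟩ : S) * t) hpx using 1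
    simp only [Subring.smul_def, Subfield.smul_def, ← Int.cast_smul_eq_zsmul ℝ, smul_smul, hk]
    congr 1
    push_cast
    rw [← hdt']
    field_simp

theorem dotProduct_mem_of_mem_span {n : ℕ} {K : Subfield ℝ} {s : Set (Fin n → ℝ)}
    (hs : ∀ x ∈ s, ∀ y ∈ s, x ⬝ᵥ y ∈ K) {x y : Fin n → ℝ} (hx : x ∈ Submodule.span K s)
    (hy : y ∈ Submodule.span K s) : x ⬝ᵥ y ∈ K := by
  induction hx, hy using Submodule.span_induction₂ with
  | mem_mem x y hx hy => exact hs x hx y hy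
  | zero_left => simp
  | zero_right => simp
  | add_left x y z _ _ _ hx hy => rw [add_dotProduct]; exact add_mem hx hy
  | add_right x y z _ _ _ hx hy => rw [dotProduct_add]; exact add_mem hx hy
  | smul_left k x y _ _ h =>
    rw [Subfield.smul_def, smul_dotProduct]
    exact mul_mem k.2 h
  | smul_right k x y _ _ h =>
    rw [Subfield.smul_def, dotProduct_smul]
    exact mul_mem k.2 h

theorem reflMatrix_mulVec_mem {n : ℕ} {K : Subfield ℝ} {V : Submodule K (Fin n → ℝ)}
    (hV : ∀ x ∈ V, ∀ y ∈ V, x ⬝ᵥ y ∈ K) {γ x : Fin n → ℝ} (hγ : γ ∈ V) (hx : x ∈ V) :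
    reflMatrix γ *ᵥ x ∈ V := by
  rw [reflMatrix_mulVec]
  have hc : 2 * (γ ⬝ᵥ x) / (γ ⬝ᵥ γ) ∈ K :=
    div_mem (mul_mem (ofNat_mem K 2) (hV γ hγ x hx)) (hV γ hγ γ hγ)
  exact sub_mem hx (V.smul_mem ⟨_, hc⟩ hγ)

/-- A Cartan–Dieudonné argument: an orthogonal matrix preserving `V` that fixes all but the
vectors indexed by `s` of a spanning family in `V` is a product of at most `#s` reflections
along vectors of any set containing a non-zero multiple of each vector of `V`. -/
theorem exists_list_reflMatrix_prod {n : ℕ} {ι : Type*} {K : Subfield ℝ}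
    {V : Submodule K (Fin n → ℝ)} (hV : ∀ x ∈ V, ∀ y ∈ V, x ⬝ᵥ y ∈ K)
    {Γ : Set (Fin n → ℝ)} (hΓ : ∀ x ∈ V, ∃ c : ℝ, c ≠ 0 ∧ c • x ∈ Γ)
    {b : ι → (Fin n → ℝ)} (hbV : ∀ i, b i ∈ V) (hb : Submodule.span ℝ (Set.range b) = ⊤)
    (s : Finset ι) {Q : Matrix (Fin n) (Fin n) ℝ} (hQ : Q ∈ orthogonalGroup (Fin n) ℝ)
    (hQV : ∀ x ∈ V, Q *ᵥ x ∈ V) (hQb : ∀ i ∉ s, Q *ᵥ b i = b i) :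
    ∃ l : List (Fin n → ℝ), l.length ≤ s.card ∧ (∀ g ∈ l, g ∈ Γ ∧ g ≠ 0) ∧
      Q = (l.map reflMatrix).prod := by
  classical
  induction s using Finset.induction_on generalizing Q with
  | empty =>
    refine ⟨[], le_rfl, by simp, ?_⟩
    have h : Q.mulVecLin = (1 : Matrix (Fin n) (Fin n) ℝ).mulVecLin :=
      LinearMap.ext_on_range hb fun i => by simpa using hQb i
    exact ext_of_mulVec_single fun i => LinearMap.congr_fun h _
  | insert i s hi ih =>
    by_cases hfix : Q *ᵥ b i = b i
    · obtain ⟨l, hl, hlΓ, hlQ⟩ := ih hQ hQV fun j hj => by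
        by_cases hji : j = i
        · rwa [hji]
        · exact hQb j (by simp [hji, hj])
      exact ⟨l, hl.trans (Finset.card_le_card (Finset.subset_insert i s)), hlΓ, hlQ⟩
    · set v := Q *ᵥ b i - b i with hv
      have hvV : v ∈ V := sub_mem (hQV _ (hbV i)) (hbV i)
      have hv0 : v ≠ 0 := sub_ne_zero.2 hfix
      obtain ⟨c, hc, hcv⟩ := hΓ v hvV
      obtain ⟨l, hl, hlΓ, hlQ⟩ := ih (Q := reflMatrix v * Q)
        (mul_mem (reflMatrix_mem_orthogonalGroup v) hQ)
        (fun x hx => by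
          rw [← mulVec_mulVec]
          exact reflMatrix_mulVec_mem hV hvV (hQV x hx))
        (fun j hj => by
          rw [← mulVec_mulVec]
          by_cases hji : j = i
          · rw [hji]
            exact reflMatrix_sub_mulVec hfix (mulVec_dotProduct_mulVec hQ _ _).symm
          · have hjf : Q *ᵥ b j = b j := hQb j (by simp [hji, hj])
            rw [hjf]
            refine reflMatrix_mulVec_of_dotProduct_eq_zero ?_
            rw [hv, sub_dotProduct, sub_eq_zero]
            conv_lhs => rw [← hjf]
            exact mulVec_dotProduct_mulVec hQ _ _)
      refine ⟨c • v :: l, ?_, ?_, ?_⟩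
      · rw [List.length_cons, Finset.card_insert_of_notMem hi]
        exact Nat.succ_le_succ hl
      · rintro g (_ | ⟨_, hg⟩)
        · exact ⟨hcv, smul_ne_zero hc hv0⟩
        · exact hlΓ g hg
      · rw [List.map_cons, List.prod_cons, ← hlQ, reflMatrix_smul hc, ← mul_assoc,
          reflMatrix_mul_self, one_mul]

theorem stmt16 {n : ℕ} (S : Subring ℝ) (hS : Module.Finite ℤ S)
    (K : Subfield ℝ)
    (hK : ∀ x : ℝ, x ∈ K ↔ ∃ a b : ℝ, a ∈ S ∧ b ∈ S ∧ b ≠ 0 ∧ x = a / b)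
    (Γ : AddSubgroup (Fin n → ℝ)) (b : Fin n → (Fin n → ℝ)) (hb : IsSBasisOf S b Γ)
    (B : Matrix (Fin n) (Fin n) ℝ) (hB : ∀ i j, B i j = b j i)
    (hGram : ∀ i j, (Bᵀ * B) i j ∈ K) :
    (∀ γ ∈ Γ, γ ≠ 0 → IsCoincidenceIsometry Γ (reflMatrix γ)) ∧
    ∀ Q : Matrix (Fin n) (Fin n) ℝ, IsCoincidenceIsometry Γ Q →
      IsProdOfAtMostNCoincReflections Γ Q := by
  set V := Submodule.span K (Set.range b)
  have hbV (i : Fin n) : b i ∈ V := Submodule.subset_span ⟨i, rfl⟩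
  have hSK {c : ℝ} (hc : c ∈ S) : c ∈ K :=
    (hK c).2 ⟨c, 1, hc, one_mem S, one_ne_zero, (div_one c).symm⟩
  have hΓV {x : Fin n → ℝ} (hx : x ∈ Γ) : x ∈ V := by
    obtain ⟨c, hc, rfl⟩ := (hb.2.2 x).1 hx
    exact sum_mem fun i _ => V.smul_mem ⟨c i, hSK (hc i)⟩ (hbV i)
  have hVΓ {x : Fin n → ℝ} (hx : x ∈ V) : ∃ m : ℤ, m ≠ 0 ∧ m • x ∈ Γ := by
    obtain ⟨m, hm, h⟩ := exists_zsmul_mem_span (fun x => (hK x).1) hx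
    exact ⟨m, hm, hb.mem_iff.2 h⟩
  have hV : ∀ x ∈ V, ∀ y ∈ V, x ⬝ᵥ y ∈ K := by
    refine fun x hx y hy => dotProduct_mem_of_mem_span ?_ hx hy
    rintro _ ⟨i, rfl⟩ _ ⟨j, rfl⟩
    simpa [mul_apply, hB, dotProduct] using hGram i j
  have hfg : AddGroup.FG Γ := hb.fg
  constructor
  · intro γ hγ _
    refine ⟨reflMatrix_mem_orthogonalGroup γ, ?_⟩
    have : AddGroup.FG (Γ.map (reflMatrix γ).mulVecLin.toAddMonoidHom) :=
      AddGroup.fg_of_surjective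
        (AddMonoidHom.addSubgroupMap_surjective (reflMatrix γ).mulVecLin.toAddMonoidHom Γ)
    refine ⟨AddSubgroup.addSubgroupOf_index_ne_zero fun x hx => ?_,
      AddSubgroup.addSubgroupOf_index_ne_zero ?_⟩
    · obtain ⟨m, hm, h⟩ := hVΓ (reflMatrix_mulVec_mem hV (hΓV hγ) (hΓV hx))
      refine ⟨m, hm, _, h, ?_⟩
      change reflMatrix γ *ᵥ (m • reflMatrix γ *ᵥ x) = m • x
      rw [mulVec_smul, mulVec_mulVec, reflMatrix_mul_self, one_mulVec]
    · rintro _ ⟨x, hx, rfl⟩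
      exact hVΓ (reflMatrix_mulVec_mem hV (hΓV hγ) (hΓV hx))
  · rintro Q ⟨hQ, -, hidx⟩
    have hQb (i : Fin n) : Q *ᵥ b i ∈ V := by
      have hbΓ : b i ∈ Γ := hb.mem_iff.2 (Submodule.subset_span ⟨i, rfl⟩)
      have h := hΓV (AddSubgroup.index_addSubgroupOf_nsmul_mem _ Γ
        (AddSubgroup.mem_map_of_mem Q.mulVecLin.toAddMonoidHom hbΓ))
      rw [← Nat.cast_smul_eq_nsmul K] at h
      exact (V.smul_mem_iff (Nat.cast_ne_zero.2 hidx)).1 h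
    have hQV : ∀ x ∈ V, Q *ᵥ x ∈ V := fun x hx => by
      have h : V ≤ V.comap (Q.mulVecLin.restrictScalars K) :=
        Submodule.span_le.2 (by rintro _ ⟨i, rfl⟩; exact hQb i)
      exact h hx
    obtain ⟨l, hl, hlΓ, rfl⟩ := exists_list_reflMatrix_prod (Γ := Γ) hV
      (fun x hx => by
        obtain ⟨m, hm, h⟩ := hVΓ hx
        exact ⟨m, Int.cast_ne_zero.2 hm, by rwa [Int.cast_smul_eq_zsmul]⟩)
      hbV hb.2.1 Finset.univ hQ hQV (by simp)
    refine ⟨l.length, by simpa using hl, fun i => l[i], fun i => hlΓ _ (List.getElem_mem _), ?_⟩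
    exact congrArg List.prod (List.ofFn_getElem_eq_map l reflMatrix).symm
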